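/- Let M be a 3-quasi-Sasakian manifold. Then there exists a unique linear connection ∇̃ on M satisfying: (i) ∇̃η_α = 0 and ∇̃ξ_α = 0 for each α ∈ {1,2,3}; (ii) ∇̃g = 0; (iii) its torsion satisfies T̃(X,Y) = 2 Σ_{α=1}^{3} dη_α(X,Y) ξ_α for all vector fields X, Y. Furthermore, for any cyclic permutation (α,β,γ) of {1,2,3}, (∇̃_X φ_α)Y = −c(η_β(X) ψ_γ(Y_H) − η_γ(X) ψ_β(Y_H)), where Y_H denotes the horizontal component of Y. -/

import Mathlib

/-!
An abstract (Lie–Rinehart style) algebraic model of the differential geometry of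
almost contact metric 3-structures: `F` plays the role of the algebra of smooth
functions on a manifold `M` of dimension `4n+3`, and `V` plays the role of the
`F`-module of smooth vector fields, acting on `F` by derivations and carrying a
Lie bracket, a Riemannian metric `g`, and three almost contact metric structures
`(φ_α, ξ_α, η_α, g)`.
-/

noncomputable section

namespace QS3

/-- Cyclic (= even) permutations of `{0,1,2}`, modelling even permutations of `{1,2,3}`. -/
def Cyclic (a b c : Fin 3) : Prop :=
  (a, b, c) = (0, 1, 2) ∨ (a, b, c) = (1, 2, 0) ∨ (a, b, c) = (2, 0, 1)

/-- The algebraic model of the smooth structure of a manifold: an `ℝ`-algebra `F`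
of smooth functions and an `F`-module `V` of vector fields acting on `F` by
derivations and carrying the Lie bracket of vector fields. -/
class SmoothSetting (F : Type) (V : Type) [CommRing F] [Algebra ℝ F]
    [AddCommGroup V] [Module F V] where
  act : V → F → F
  bracket : V → V → V
  act_add : ∀ (X : V) (f₁ f₂ : F), act X (f₁ + f₂) = act X f₁ + act X f₂
  act_mul : ∀ (X : V) (f₁ f₂ : F), act X (f₁ * f₂) = act X f₁ * f₂ + f₁ * act X f₂
  act_const : ∀ (X : V) (r : ℝ), act X (algebraMap ℝ F r) = 0
  act_addLeft : ∀ (X Y : V) (f : F), act (X + Y) f = act X f + act Y f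
  act_smulLeft : ∀ (f : F) (X : V) (h : F), act (f • X) h = f * act X h
  bracket_antisymm : ∀ X Y : V, bracket X Y = -bracket Y X
  bracket_addLeft : ∀ X Y Z : V, bracket (X + Y) Z = bracket X Z + bracket Y Z
  bracket_act : ∀ (X Y : V) (f : F),
    act (bracket X Y) f = act X (act Y f) - act Y (act X f)
  bracket_smulRight : ∀ (X : V) (f : F) (Y : V),
    bracket X (f • Y) = f • bracket X Y + act X f • Y
  jacobi : ∀ X Y Z : V,
    bracket X (bracket Y Z) + bracket Y (bracket Z X) + bracket Z (bracket X Y) = 0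

section d

variable (F V : Type) [CommRing F] [Algebra ℝ F] [AddCommGroup V] [Module F V]
  [SmoothSetting F V]

/-- The action of a vector field on a function (directional derivative). -/
def der (X : V) (f : F) : F := SmoothSetting.act X f

/-- The Lie bracket of vector fields. -/
def lie (X Y : V) : V := SmoothSetting.bracket F X Y

/-- Exterior differential of a 1-form (with the `1/2` normalization convention,
so that `2 dθ(X,Y) = X θ(Y) - Y θ(X) - θ([X,Y])`). -/
def dOne (θ : V → F) (X Y : V) : F :=
  (2 : ℝ)⁻¹ • (der F V X (θ Y) - der F V Y (θ X) - θ (lie F V X Y))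

/-- Exterior differential of a 2-form (with the `1/3` normalization convention). -/
def dTwo (ω : V → V → F) (X Y Z : V) : F :=
  (3 : ℝ)⁻¹ • (der F V X (ω Y Z) + der F V Y (ω Z X) + der F V Z (ω X Y)
    - ω (lie F V X Y) Z - ω (lie F V Y Z) X - ω (lie F V Z X) Y)

end d

/-- An almost contact metric 3-structure on a manifold of dimension `4n+3`:
three almost contact metric structures `(φ_α, ξ_α, η_α, g)` satisfying the
quaternionic-type relations, together with a (local) orthonormal frame. -/
class ACM3 (F V : Type) [CommRing F] [Algebra ℝ F] [AddCommGroup V] [Module F V]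
    [SmoothSetting F V] where
  n : ℕ
  g : V → V → F
  phi : Fin 3 → V → V
  xi : Fin 3 → V
  eta : Fin 3 → V → F
  g_symm : ∀ X Y, g X Y = g Y X
  g_addLeft : ∀ X Y Z, g (X + Y) Z = g X Z + g Y Z
  g_smulLeft : ∀ (f : F) (X Y : V), g (f • X) Y = f * g X Y
  g_nondeg : ∀ X, (∀ Y, g X Y = 0) → X = 0
  phi_add : ∀ α (X Y : V), phi α (X + Y) = phi α X + phi α Y
  phi_smul : ∀ α (f : F) (X : V), phi α (f • X) = f • phi α X
  eta_eq : ∀ α X, eta α X = g X (xi α)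
  acm_sq : ∀ α X, phi α (phi α X) = -X + eta α X • xi α
  eta_xi : ∀ α, eta α (xi α) = 1
  compat : ∀ α X Y, g (phi α X) (phi α Y) = g X Y - eta α X * eta α Y
  quat_phi : ∀ a b c, Cyclic a b c → ∀ X, phi c X = phi a (phi b X) - eta b X • xi a
  quat_phi' : ∀ a b c, Cyclic a b c → ∀ X, phi c X = -(phi b (phi a X)) + eta a X • xi b
  quat_xi : ∀ a b c, Cyclic a b c → xi c = phi a (xi b)
  quat_xi' : ∀ a b c, Cyclic a b c → xi c = -(phi b (xi a))
  quat_eta : ∀ a b c, Cyclic a b c → ∀ X, eta c X = eta a (phi b X)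
  quat_eta' : ∀ a b c, Cyclic a b c → ∀ X, eta c X = -(eta b (phi a X))
  frame : Fin (4 * n + 3) → V
  frame_orth : ∀ i j, g (frame i) (frame j) = if i = j then 1 else 0
  frame_span : ∀ X : V, X = ∑ i, g X (frame i) • frame i

section acm

variable (F V : Type) [CommRing F] [Algebra ℝ F] [AddCommGroup V] [Module F V]
  [SmoothSetting F V] [ACM3 F V]

/-- The integer `n` (the manifold has dimension `4n+3`). -/
def dimn : ℕ := ACM3.n F V

/-- The Riemannian metric. -/
def gm (X Y : V) : F := ACM3.g X Y

/-- The structure tensors `φ_α`. -/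
def ph (α : Fin 3) (X : V) : V := ACM3.phi F α X

/-- The Reeb vector fields `ξ_α`. -/
def rxi (α : Fin 3) : V := ACM3.xi F α

/-- The 1-forms `η_α`. -/
def et (α : Fin 3) (X : V) : F := ACM3.eta α X

/-- The orthonormal frame. -/
def fr (i : Fin (4 * dimn F V + 3)) : V := ACM3.frame i

/-- The fundamental 2-form `Φ_α(X,Y) = g(X, φ_α Y)`. -/
def Phi (α : Fin 3) (X Y : V) : F := gm F V X (ph F V α Y)

/-- The Nijenhuis torsion `[φ_α, φ_α]` of `φ_α`. -/
def Nij (α : Fin 3) (X Y : V) : V :=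
  ph F V α (ph F V α (lie F V X Y)) + lie F V (ph F V α X) (ph F V α Y)
    - ph F V α (lie F V (ph F V α X) Y) - ph F V α (lie F V X (ph F V α Y))

/-- The normality tensor `N⁽¹⁾_α = [φ_α, φ_α] + 2 dη_α ⊗ ξ_α`. -/
def NOne (α : Fin 3) (X Y : V) : V :=
  Nij F V α X Y + ((2 : ℝ) • dOne F V (et F V α) X Y) • rxi F V α

/-- The structure `(φ_α, ξ_α, η_α)` is normal. -/
def IsNormal (α : Fin 3) : Prop := ∀ X Y, NOne F V α X Y = 0

/-- A 2-form is closed. -/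
def IsClosedTwo (ω : V → V → F) : Prop := ∀ X Y Z, dTwo F V ω X Y Z = 0

/-- The structure `(φ_α, ξ_α, η_α, g)` is quasi-Sasakian: normal with closed
fundamental 2-form. -/
def IsQuasiSasakian (α : Fin 3) : Prop :=
  IsNormal F V α ∧ IsClosedTwo F V (Phi F V α)

/-- `M` is 3-cosymplectic: each structure is normal with `dη_α = 0` and `dΦ_α = 0`. -/
def ThreeCosymplectic : Prop :=
  ∀ α, IsNormal F V α ∧ (∀ X Y, dOne F V (et F V α) X Y = 0) ∧
    IsClosedTwo F V (Phi F V α)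

/-- `M` is 3-α-Sasakian with constant `a ≠ 0`: each structure is normal (an
`α`-Sasakian structure) and `dη_δ = a Φ_δ`. -/
def Is3AlphaSasakianWith (a : ℝ) : Prop :=
  a ≠ 0 ∧ (∀ δ, IsNormal F V δ) ∧
    ∀ (δ : Fin 3) (X Y : V), dOne F V (et F V δ) X Y = algebraMap ℝ F a * Phi F V δ X Y

/-- A vector field is horizontal: it lies in `H = ∩_α ker η_α`. -/
def Horiz (X : V) : Prop := ∀ α, et F V α X = 0

/-- A vector field is vertical: it lies in `V = ⟨ξ₁, ξ₂, ξ₃⟩`. -/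
def InVert (X : V) : Prop :=
  ∃ p q r : F, X = p • rxi F V 0 + q • rxi F V 1 + r • rxi F V 2

/-- The distribution `E^{4m} = {X ∈ H : i_X dη_α = 0}`. -/
def InE4m (X : V) : Prop :=
  Horiz F V X ∧ ∀ (α : Fin 3) (Y : V), dOne F V (et F V α) X Y = 0

/-- The distribution `E^{4l}`: the orthogonal complement of `E^{4m}` in `H`. -/
def InE4l (X : V) : Prop :=
  Horiz F V X ∧ ∀ Y, InE4m F V Y → gm F V X Y = 0

/-- The distribution `E^{4l+3} = E^{4l} ⊕ V`. -/
def InE4l3 (X : V) : Prop :=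
  ∃ Y Z, InE4l F V Y ∧ InVert F V Z ∧ X = Y + Z

/-- The distribution `E^{4m+3} = E^{4m} ⊕ V`. -/
def InE4m3 (X : V) : Prop :=
  ∃ Y Z, InE4m F V Y ∧ InVert F V Z ∧ X = Y + Z

/-- The horizontal component `X_H = X - ∑_α η_α(X) ξ_α` of a vector field. -/
def horComp (X : V) : V := X - ∑ α : Fin 3, et F V α X • rxi F V α

/-- A vector field is basic with respect to the foliation defined by `E^{4m}`. -/
def BasicE4m (X : V) : Prop :=
  InE4l3 F V X ∧ ∀ W, InE4m F V W → InE4m F V (lie F V W X)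

/-- A vector field is basic with respect to the foliation defined by `E^{4l+3}`. -/
def BasicE4l3 (X : V) : Prop :=
  InE4m F V X ∧ ∀ W, InE4l3 F V W → InE4l3 F V (lie F V W X)

end acm

/-- A 3-quasi-Sasakian structure: each of the three almost contact metric
structures is quasi-Sasakian.  We also record, as part of the structure, the
standard structural facts established for such manifolds in the literature
(Cappelletti Montano–De Nicola–Dileo): the Reeb commutation relations
`[ξ_α, ξ_β] = c ξ_γ`, the splitting `H = E^{4l} ⊕ E^{4m}` (constancy of the
rank), the `φ_α`-invariance of both distributions, and the tensors `ψ_α`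
(equal to `φ_α` on `E^{4l+3}` and vanishing on `E^{4m}` when the rank is
`4l+3`, i.e. `c ≠ 0`; equal to `φ_α` on `E^{4l}` and vanishing on `E^{4m+3}`
when the rank is `4l+1`, i.e. `c = 0`). -/
class ThreeQS (F V : Type) [CommRing F] [Algebra ℝ F] [AddCommGroup V] [Module F V]
    [SmoothSetting F V] [ACM3 F V] where
  qs : ∀ α, IsQuasiSasakian F V α
  c : ℝ
  reeb_bracket : ∀ a b c', Cyclic a b c' →
    lie F V (rxi F V a) (rxi F V b) = algebraMap ℝ F c • rxi F V c'
  horiz_split : ∀ X, Horiz F V X → ∃ Y Z, InE4l F V Y ∧ InE4m F V Z ∧ X = Y + Z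
  phi_E4l : ∀ α X, InE4l F V X → InE4l F V (ph F V α X)
  phi_E4m : ∀ α X, InE4m F V X → InE4m F V (ph F V α X)
  psi : Fin 3 → V → V
  psi_add : ∀ α (X Y : V), psi α (X + Y) = psi α X + psi α Y
  psi_smul : ∀ α (f : F) (X : V), psi α (f • X) = f • psi α X
  psi_E4l : ∀ α X, InE4l F V X → psi α X = ph F V α X
  psi_E4m : ∀ α X, InE4m F V X → psi α X = 0
  psi_vert_of_ne : c ≠ 0 → ∀ α β, psi α (rxi F V β) = ph F V α (rxi F V β)
  psi_vert_of_eq : c = 0 → ∀ α β, psi α (rxi F V β) = 0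

section tqs

variable (F V : Type) [CommRing F] [Algebra ℝ F] [AddCommGroup V] [Module F V]
  [SmoothSetting F V] [ACM3 F V] [ThreeQS F V]

/-- The constant `c` with `[ξ_α, ξ_β] = c ξ_γ`. -/
def cc : ℝ := ThreeQS.c F V

/-- The tensors `ψ_α`. -/
def psiT (α : Fin 3) (X : V) : V := ThreeQS.psi F α X

/-- The tensors `θ_α = φ_α - ψ_α`. -/
def thetaT (α : Fin 3) (X : V) : V := ph F V α X - psiT F V α X

/-- The 2-forms `Θ_α(X,Y) = g(X, θ_α Y)`. -/
def ThetaForm (α : Fin 3) (X Y : V) : F := gm F V X (thetaT F V α Y)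

end tqs

/-- The 3-quasi-Sasakian manifold has rank `4l+3`: the constant `c` is nonzero
and the orthonormal frame is adapted to the splitting
`TM = E^{4l} ⊕ E^{4m} ⊕ ⟨ξ₁,ξ₂,ξ₃⟩` with `dim E^{4l} = 4l` (hence
`dim E^{4m} = 4m`, `m = n - l`, and the rank of the `η_α` is `4l+3`). -/
class HasRank (F V : Type) [CommRing F] [Algebra ℝ F] [AddCommGroup V] [Module F V]
    [SmoothSetting F V] [ACM3 F V] [ThreeQS F V] (l : ℕ) : Prop where
  c_ne : cc F V ≠ 0
  l_le : l ≤ dimn F V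
  frame_E4l : ∀ i : Fin (4 * dimn F V + 3), i.val < 4 * l → InE4l F V (fr F V i)
  frame_E4m : ∀ i : Fin (4 * dimn F V + 3), 4 * l ≤ i.val → i.val < 4 * dimn F V →
    InE4m F V (fr F V i)
  frame_xi : ∀ (i : Fin (4 * dimn F V + 3)) (a : Fin 3),
    i.val = 4 * dimn F V + a.val → fr F V i = rxi F V a

/-- The Levi-Civita connection of `g`: the unique torsion-free metric connection. -/
class LeviCivita (F V : Type) [CommRing F] [Algebra ℝ F] [AddCommGroup V] [Module F V]
    [SmoothSetting F V] [ACM3 F V] where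
  nabla : V → V → V
  nabla_addLeft : ∀ X Y Z : V, nabla (X + Y) Z = nabla X Z + nabla Y Z
  nabla_smulLeft : ∀ (f : F) (X Y : V), nabla (f • X) Y = f • nabla X Y
  nabla_addRight : ∀ X Y Z : V, nabla X (Y + Z) = nabla X Y + nabla X Z
  nabla_leibniz : ∀ (X : V) (f : F) (Y : V),
    nabla X (f • Y) = der F V X f • Y + f • nabla X Y
  nabla_metric : ∀ X Y Z : V,
    der F V X (gm F V Y Z) = gm F V (nabla X Y) Z + gm F V Y (nabla X Z)
  nabla_torsionFree : ∀ X Y : V, nabla X Y - nabla Y X = lie F V X Y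

section curv

variable (F V : Type) [CommRing F] [Algebra ℝ F] [AddCommGroup V] [Module F V]
  [SmoothSetting F V] [ACM3 F V] [LeviCivita F V]

/-- The Levi-Civita covariant derivative `∇_X Y`. -/
def nab (X Y : V) : V := LeviCivita.nabla F X Y

/-- The Riemannian curvature `R(X,Y)Z = ∇_X ∇_Y Z - ∇_Y ∇_X Z - ∇_{[X,Y]} Z`. -/
def Rcurv (X Y Z : V) : V :=
  nab F V X (nab F V Y Z) - nab F V Y (nab F V X Z) - nab F V (lie F V X Y) Z

/-- The Ricci tensor `Ric(X,Y) = ∑_i g(R(e_i, X)Y, e_i)`. -/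
def Ric (X Y : V) : F :=
  ∑ i, gm F V (Rcurv F V (fr F V i) X Y) (fr F V i)

/-- The scalar curvature. -/
def Scal : F := ∑ i, Ric F V (fr F V i) (fr F V i)

/-- `M` is Einstein: `Ric = a g` for a constant `a`. -/
def Einstein : Prop :=
  ∃ a : ℝ, ∀ X Y, Ric F V X Y = algebraMap ℝ F a * gm F V X Y

/-- `M` is η-Einstein: `Ric = a g + b ∑_α η_α ⊗ η_α` for constants `a, b`. -/
def EtaEinstein : Prop :=
  ∃ a b : ℝ, ∀ X Y, Ric F V X Y
    = algebraMap ℝ F a * gm F V X Y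
      + algebraMap ℝ F b * ∑ α : Fin 3, et F V α X * et F V α Y

end curv

/-- A (Koszul) linear connection on vector fields. -/
def IsConnection (F V : Type) [CommRing F] [Algebra ℝ F] [AddCommGroup V] [Module F V]
    [SmoothSetting F V] (D : V → V → V) : Prop :=
  (∀ X Y Z : V, D (X + Y) Z = D X Z + D Y Z) ∧
  (∀ (f : F) (X Y : V), D (f • X) Y = f • D X Y) ∧
  (∀ X Y Z : V, D X (Y + Z) = D X Y + D X Z) ∧
  (∀ (X : V) (f : F) (Y : V), D X (f • Y) = der F V X f • Y + f • D X Y)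

end QS3

namespace QS3

lemma half_mul_two (F : Type) [CommRing F] [Algebra ℝ F] : algebraMap ℝ F 2⁻¹ * 2 = 1 := by
  rw [← map_ofNat (algebraMap ℝ F) 2, ← map_mul]
  norm_num

section smooth

variable {F V : Type} [CommRing F] [Algebra ℝ F] [AddCommGroup V] [Module F V]
  [SmoothSetting F V]

lemma der_add (X : V) (f g : F) : der F V X (f + g) = der F V X f + der F V X g :=
  SmoothSetting.act_add X f g

lemma der_mul (X : V) (f g : F) : der F V X (f * g) = der F V X f * g + f * der F V X g :=
  SmoothSetting.act_mul X f g

lemma der_const (X : V) (r : ℝ) : der F V X (algebraMap ℝ F r) = 0 :=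
  SmoothSetting.act_const X r

lemma der_add_left (X Y : V) (f : F) : der F V (X + Y) f = der F V X f + der F V Y f :=
  SmoothSetting.act_addLeft X Y f

lemma der_smul_left (f : F) (X : V) (g : F) : der F V (f • X) g = f * der F V X g :=
  SmoothSetting.act_smulLeft f X g

lemma der_zero (X : V) : der F V X 0 = 0 := by
  have h := der_add (F := F) X 0 0
  rw [add_zero] at h
  linear_combination -h

lemma der_one (X : V) : der F V X 1 = 0 := by
  simpa using der_const (F := F) X 1

lemma der_neg (X : V) (f : F) : der F V X (-f) = -der F V X f := by
  have h := der_add X f (-f)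
  rw [add_neg_cancel, der_zero] at h
  linear_combination -h

lemma lie_skew (X Y : V) : lie F V X Y = -lie F V Y X :=
  SmoothSetting.bracket_antisymm X Y

lemma lie_add_left (X Y Z : V) : lie F V (X + Y) Z = lie F V X Z + lie F V Y Z :=
  SmoothSetting.bracket_addLeft X Y Z

lemma lie_add_right (X Y Z : V) : lie F V X (Y + Z) = lie F V X Y + lie F V X Z := by
  rw [lie_skew, lie_add_left, lie_skew Y X, lie_skew Z X]
  abel

lemma lie_smul_right (X : V) (f : F) (Y : V) :
    lie F V X (f • Y) = f • lie F V X Y + der F V X f • Y :=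
  SmoothSetting.bracket_smulRight X f Y

lemma lie_smul_left (f : F) (X Y : V) :
    lie F V (f • X) Y = f • lie F V X Y - der F V Y f • X := by
  rw [lie_skew, lie_smul_right, lie_skew X Y]
  module

lemma lie_neg_left (X Y : V) : lie F V (-X) Y = -lie F V X Y := by
  simpa [der_neg, der_one] using lie_smul_left (F := F) (-1) X Y

lemma lie_neg_right (X Y : V) : lie F V X (-Y) = -lie F V X Y := by
  rw [lie_skew, lie_neg_left, lie_skew Y X, neg_neg]

lemma lie_self (X : V) : lie F V X X = 0 := by
  have h := lie_skew (F := F) X X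
  have h2 : (2 : F) • lie F V X X = 0 := by
    rw [two_smul]
    nth_rw 1 [h]
    simp
  rw [← one_smul F (lie F V X X), ← half_mul_two F, mul_smul, h2, smul_zero]

lemma lie_jacobi (X Y Z : V) :
    lie F V X (lie F V Y Z) = lie F V (lie F V X Y) Z + lie F V Y (lie F V X Z) := by
  have h : lie F V X (lie F V Y Z) + lie F V Y (lie F V Z X) + lie F V Z (lie F V X Y) = 0 :=
    SmoothSetting.jacobi X Y Z
  rw [lie_skew Z X, lie_neg_right, lie_skew Z] at h
  rw [← sub_eq_zero, ← h]
  abel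

lemma eq_zero_of_add_self {f : F} (h : f + f = 0) : f = 0 := by
  linear_combination algebraMap ℝ F 2⁻¹ * h - f * half_mul_two F

lemma lie_algebraMap_smul (X : V) (r : ℝ) (Y : V) :
    lie F V X (algebraMap ℝ F r • Y) = algebraMap ℝ F r • lie F V X Y := by
  rw [lie_smul_right, der_const, zero_smul, add_zero]

end smooth

section metric

variable {F V : Type} [CommRing F] [Algebra ℝ F] [AddCommGroup V] [Module F V]
  [SmoothSetting F V] [ACM3 F V]

lemma gm_comm (X Y : V) : gm F V X Y = gm F V Y X := ACM3.g_symm X Y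

lemma gm_add_left (X Y Z : V) : gm F V (X + Y) Z = gm F V X Z + gm F V Y Z :=
  ACM3.g_addLeft X Y Z

lemma gm_smul_left (f : F) (X Y : V) : gm F V (f • X) Y = f * gm F V X Y :=
  ACM3.g_smulLeft f X Y

lemma gm_add_right (X Y Z : V) : gm F V X (Y + Z) = gm F V X Y + gm F V X Z := by
  rw [gm_comm, gm_add_left, gm_comm Y, gm_comm Z]

lemma gm_smul_right (f : F) (X Y : V) : gm F V X (f • Y) = f * gm F V X Y := by
  rw [gm_comm, gm_smul_left, gm_comm Y]

lemma gm_zero_left (X : V) : gm F V 0 X = 0 := by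
  simpa using gm_smul_left (F := F) 0 0 X

lemma gm_zero_right (X : V) : gm F V X 0 = 0 := by
  rw [gm_comm, gm_zero_left]

lemma gm_neg_left (X Y : V) : gm F V (-X) Y = -gm F V X Y := by
  simpa using gm_smul_left (F := F) (-1) X Y

lemma gm_neg_right (X Y : V) : gm F V X (-Y) = -gm F V X Y := by
  rw [gm_comm, gm_neg_left, gm_comm]

lemma gm_sub_left (X Y Z : V) : gm F V (X - Y) Z = gm F V X Z - gm F V Y Z := by
  rw [sub_eq_add_neg, gm_add_left, gm_neg_left, sub_eq_add_neg]

lemma gm_sub_right (X Y Z : V) : gm F V X (Y - Z) = gm F V X Y - gm F V X Z := by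
  rw [sub_eq_add_neg, gm_add_right, gm_neg_right, sub_eq_add_neg]

variable (F) in
lemma gm_ext {X Y : V} (h : ∀ Z, gm F V X Z = gm F V Y Z) : X = Y := by
  rw [← sub_eq_zero]
  refine ACM3.g_nondeg (F := F) _ fun Z => ?_
  change gm F V (X - Y) Z = 0
  rw [gm_sub_left, h, sub_self]

/-- The vector field metrically dual to a 1-form. -/
def sharp (θ : V → F) : V := ∑ i, θ (fr F V i) • fr F V i

lemma gm_sharp (θ : V →ₗ[F] F) (Z : V) : gm F V (sharp θ) Z = θ Z := by
  have hZ : Z = ∑ i, gm F V Z (fr F V i) • fr F V i := ACM3.frame_span Z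
  have hsum : ∀ s : Finset (Fin (4 * dimn F V + 3)),
      gm F V (∑ i ∈ s, θ (fr F V i) • fr F V i) Z
        = ∑ i ∈ s, θ (fr F V i) * gm F V (fr F V i) Z := by
    intro s
    induction s using Finset.induction_on with
    | empty => simp [gm_zero_left]
    | insert i s hi ih => rw [Finset.sum_insert hi, Finset.sum_insert hi, gm_add_left,
        gm_smul_left, ih]
  rw [sharp, hsum]
  conv_rhs => rw [hZ, map_sum]
  refine Finset.sum_congr rfl fun i _ => ?_
  rw [map_smul, smul_eq_mul, gm_comm, mul_comm]

/-- The Koszul expression `2 g(D_X Y, Z)` of a metric connection `D` with torsion `T`. -/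
def koszul (T : V → V → V) (X Y Z : V) : F :=
  der F V X (gm F V Y Z) + der F V Y (gm F V Z X) - der F V Z (gm F V X Y)
    + gm F V (lie F V X Y) Z - gm F V (lie F V Y Z) X + gm F V (lie F V Z X) Y
    + gm F V (T X Y) Z - gm F V (T Y Z) X + gm F V (T Z X) Y

/-- The metric connection with torsion `T`. -/
def metricConn (F : Type) {V : Type} [CommRing F] [Algebra ℝ F] [AddCommGroup V] [Module F V]
    [SmoothSetting F V] [ACM3 F V] (T : V → V → V) (X Y : V) : V :=
  sharp fun Z => algebraMap ℝ F 2⁻¹ * koszul T X Y Z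

section torsion

variable {T : V → V → V} (hskew : ∀ X Y, T X Y = -T Y X)
  (hadd : ∀ X Y Z, T (X + Y) Z = T X Z + T Y Z)
  (hsmul : ∀ (f : F) (X Y : V), T (f • X) Y = f • T X Y)

include hskew hadd in
lemma torsion_add_right (X Y Z : V) : T X (Y + Z) = T X Y + T X Z := by
  rw [hskew, hadd, hskew Y X, hskew Z X]
  abel

omit [Algebra ℝ F] [SmoothSetting F V] [ACM3 F V] in
include hskew hsmul in
lemma torsion_smul_right (f : F) (X Y : V) : T X (f • Y) = f • T X Y := by
  rw [hskew, hsmul, hskew Y X, smul_neg, neg_neg]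

include hskew hadd hsmul in
lemma gm_metricConn (X Y Z : V) :
    gm F V (metricConn F T X Y) Z = algebraMap ℝ F 2⁻¹ * koszul T X Y Z := by
  have hadd' := torsion_add_right hskew hadd
  have hsmul' := torsion_smul_right hskew hsmul
  refine gm_sharp (IsLinearMap.mk' (fun Z => algebraMap ℝ F 2⁻¹ * koszul T X Y Z)
    ⟨fun Z W => ?_, fun f Z => ?_⟩) Z
  · simp only [koszul, gm_add_left, gm_add_right, der_add, der_add_left, lie_add_left,
      lie_add_right, hadd, hadd']
    ring
  · simp only [koszul, gm_smul_left, gm_smul_right, der_mul, der_smul_left, lie_smul_left,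
      lie_smul_right, hsmul, hsmul', gm_add_left, gm_sub_left, smul_eq_mul, gm_comm Z X,
      gm_comm Z Y]
    ring

include hskew hadd hsmul in
lemma metricConn_isConnection : IsConnection F V (metricConn F T) := by
  have hadd' := torsion_add_right hskew hadd
  have hsmul' := torsion_smul_right hskew hsmul
  have key := gm_metricConn hskew hadd hsmul
  refine ⟨fun X Y Z => gm_ext F fun W => ?_, fun f X Y => gm_ext F fun W => ?_,
    fun X Y Z => gm_ext F fun W => ?_, fun X f Y => gm_ext F fun W => ?_⟩
  · rw [gm_add_left, key, key, key]
    simp only [koszul, gm_add_left, gm_add_right, der_add, der_add_left, lie_add_left,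
      lie_add_right, hadd, hadd']
    ring
  · rw [gm_smul_left, key, key]
    simp only [koszul, gm_smul_left, gm_smul_right, der_mul, der_smul_left, lie_smul_left,
      lie_smul_right, hsmul, hsmul', gm_add_left, gm_sub_left, gm_comm X W, gm_comm X Y]
    ring
  · rw [gm_add_left, key, key, key]
    simp only [koszul, gm_add_left, gm_add_right, der_add, der_add_left, lie_add_left,
      lie_add_right, hadd, hadd']
    ring
  · rw [gm_add_left, gm_smul_left, gm_smul_left, key, key]
    simp only [koszul, gm_smul_left, gm_smul_right, der_mul, der_smul_left, lie_smul_left,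
      lie_smul_right, hsmul, hsmul', gm_add_left, gm_sub_left, gm_comm Y X, gm_comm W X,
      gm_comm Y W]
    linear_combination der F V X f * gm F V W Y * half_mul_two F

include hskew hadd hsmul in
lemma metricConn_metric (X Y Z : V) :
    der F V X (gm F V Y Z)
      = gm F V (metricConn F T X Y) Z + gm F V Y (metricConn F T X Z) := by
  have key := gm_metricConn hskew hadd hsmul
  rw [gm_comm Y (metricConn F T X Z), key, key]
  simp only [koszul, hskew Y X, hskew Z X, hskew Z Y, lie_skew (F := F) Y X,
    lie_skew (F := F) Z X, lie_skew (F := F) Z Y, gm_neg_left, gm_comm Y X, gm_comm Z X,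
    gm_comm Z Y]
  linear_combination -der F V X (gm F V Y Z) * half_mul_two F

include hskew hadd hsmul in
lemma metricConn_torsion (X Y : V) :
    metricConn F T X Y - metricConn F T Y X - lie F V X Y = T X Y := by
  have key := gm_metricConn hskew hadd hsmul
  refine gm_ext F fun Z => ?_
  rw [gm_sub_left, gm_sub_left, key, key]
  simp only [koszul, hskew Y X, hskew Z X, hskew Z Y, lie_skew (F := F) Y X,
    lie_skew (F := F) Z X, lie_skew (F := F) Z Y, gm_neg_left, gm_comm Y X, gm_comm Z X,
    gm_comm Z Y]
  linear_combination (gm F V (T X Y) Z + gm F V (lie F V X Y) Z) * half_mul_two F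

end torsion

/-- A trilinear-type expression symmetric in the first two arguments and skew in the last two
vanishes. -/
lemma eq_zero_of_symm_of_skew {ι : Type} {p : ι → Prop} {S : ι → ι → ι → F}
    (hs : ∀ X Y Z, p X → p Y → p Z → S X Y Z = S Y X Z)
    (hk : ∀ X Y Z, p X → p Y → p Z → S X Y Z = -S X Z Y) {X Y Z : ι}
    (hX : p X) (hY : p Y) (hZ : p Z) : S X Y Z = 0 := by
  apply eq_zero_of_add_self
  linear_combination hs X Y Z hX hY hZ + hk Y X Z hY hX hZ - hs Y Z X hY hZ hX
    - hk Z Y X hZ hY hX + hs Z X Y hZ hX hY + hk X Z Y hX hZ hY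

lemma metric_connection_unique {D D' : V → V → V}
    (hm : ∀ X Y Z : V,
      der F V X (gm F V Y Z) = gm F V (D X Y) Z + gm F V Y (D X Z))
    (hm' : ∀ X Y Z : V,
      der F V X (gm F V Y Z) = gm F V (D' X Y) Z + gm F V Y (D' X Z))
    (ht : ∀ X Y : V, D X Y - D Y X = D' X Y - D' Y X) : D' = D := by
  funext X Y
  refine gm_ext F fun Z => ?_
  have h := eq_zero_of_symm_of_skew (p := fun _ : V => True)
    (S := fun X Y Z => gm F V (D' X Y) Z - gm F V (D X Y) Z)
    (fun X Y Z _ _ _ => ?_) (fun X Y Z _ _ _ => ?_) (X := X) (Y := Y) (Z := Z)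
    trivial trivial trivial
  · linear_combination h
  · have := congrArg (gm F V · Z) (ht X Y)
    simp only [gm_sub_left] at this
    linear_combination -this
  · rw [gm_comm (D' X Z) Y, gm_comm (D X Z) Y]
    linear_combination hm X Y Z - hm' X Y Z

end metric


lemma Cyclic.rotate {a b c : Fin 3} (h : Cyclic a b c) : Cyclic b c a := by
  simp only [Cyclic, Prod.mk.injEq] at h ⊢
  tauto

/-- Let `φ 0, φ 1, φ 2` satisfy the quaternion relations, and let `l 0, l 1, l 2` span a copy of
`so(3)` with structure constant `k`, where `[l a, φ a] = 0` and `[l b, φ a] = -[l a, φ b]`. Then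
`[l a, φ b] = -φ c * B` for a common `B` commuting with every `φ a` and with `B * (B + k) = 0`. -/
lemma exists_commutator_eq {R : Type*} [Ring R] {φ l : Fin 3 → R} {k : R}
    (h2 : ∀ x : R, x + x = 0 → x = 0)
    (hsq : ∀ a, φ a * φ a = -1)
    (hφ : ∀ a b c, Cyclic a b c → φ a * φ b = φ c)
    (hφ' : ∀ a b c, Cyclic a b c → φ b * φ a = -φ c)
    (hl : ∀ a b c, Cyclic a b c → l a * l b - l b * l a = k * l c)
    (hc : ∀ a, l a * φ a = φ a * l a)
    (hk : ∀ a, k * φ a = φ a * k) (hkl : ∀ a, k * l a = l a * k)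
    (ha : ∀ a b c, Cyclic a b c → l b * φ a - φ a * l b = -(l a * φ b - φ b * l a)) :
    ∃ B : R, (∀ a b c, Cyclic a b c → B = (l b * φ c - φ c * l b) * φ a) ∧
      (∀ a, B * φ a = φ a * B) ∧
      (∀ a b c, Cyclic a b c → l a * φ b - φ b * l a = -(φ c * B)) ∧
      B * (B + k) = 0 := by
  obtain ⟨A, hA⟩ : ∃ A : Fin 3 → R, ∀ a b c, Cyclic a b c → l a * φ b - φ b * l a = A c := by
    refine ⟨fun c => l (c + 1) * φ (c + 2) - φ (c + 2) * l (c + 1), fun a b c h => ?_⟩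
    simp only [Cyclic, Prod.mk.injEq] at h
    obtain ⟨rfl, rfl, rfl⟩ | ⟨rfl, rfl, rfl⟩ | ⟨rfl, rfl, rfl⟩ := h <;> rfl
  have hA' : ∀ a b c, Cyclic a b c → l b * φ a - φ a * l b = -A c := fun a b c h => by
    rw [ha a b c h, hA a b c h]
  have e1 : ∀ a b c, Cyclic a b c → A b * φ b = φ a * A a := fun a b c h => by
    have : A b * φ b - φ a * A a = l c * (φ a * φ b) - (φ a * φ b) * l c := by
      rw [← hA c a b h.rotate.rotate, ← neg_neg (A a), ← hA' b c a h.rotate]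
      noncomm_ring
    rwa [hφ a b c h, hc, sub_self, sub_eq_zero] at this
  have e2 : ∀ a b c, Cyclic a b c → φ b * A b = A a * φ a := fun a b c h => by
    have : φ b * A b - A a * φ a = l c * (φ b * φ a) - (φ b * φ a) * l c := by
      rw [← hA c a b h.rotate.rotate, ← neg_neg (A a), ← hA' b c a h.rotate]
      noncomm_ring
    rwa [hφ' a b c h, mul_neg, neg_mul, hc, sub_self, sub_eq_zero] at this
  have c012 : Cyclic 0 1 2 := Or.inl rfl
  have hall : ∀ P : Fin 3 → Prop, (∀ a b c, Cyclic a b c → P a) → ∀ a, P a := by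
    intro P hP a
    fin_cases a
    exacts [hP _ _ _ c012, hP _ _ _ c012.rotate, hP _ _ _ c012.rotate.rotate]
  have hcyc : ∀ a b c, Cyclic a b c → A a * φ a = A c * φ c := fun a b c h => by
    rw [← e2 a b c h, e1 b c a h.rotate]
  have hcomm : ∀ a, A a * φ a = φ a * A a := hall _ fun a b c h => by
    rw [hcyc a b c h, e2 c a b h.rotate.rotate]
  obtain ⟨B, hB⟩ : ∃ B, ∀ a, B = A a * φ a := by
    refine ⟨A 0 * φ 0, fun a => ?_⟩
    fin_cases a
    exacts [rfl, (hcyc _ _ _ c012.rotate).symm, hcyc _ _ _ c012]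
  have hAB : ∀ a, A a = -(φ a * B) := fun a => by
    rw [hB a, hcomm, ← mul_assoc, hsq]
    simp
  have hBφ : ∀ a, B * φ a = φ a * B := fun a => by
    rw [hB a]
    nth_rw 1 [hcomm]
    rw [mul_assoc]
  have d1 : ∀ a b c, Cyclic a b c → l a * A a - A a * l a = -(l b * A b - A b * l b) :=
    fun a b c h => by
      have : l a * A a - A a * l a + (l b * A b - A b * l b)
          = (l a * l b - l b * l a) * φ c - φ c * (l a * l b - l b * l a) := by
        rw [← hA b c a h.rotate, ← neg_neg (A b), ← hA' c a b h.rotate.rotate]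
        noncomm_ring
      rw [hl a b c h, mul_assoc, hc, ← mul_assoc, ← mul_assoc, hk, sub_self] at this
      exact eq_neg_of_add_eq_zero_left this
  have d2 : ∀ a b c, Cyclic a b c → l a * A b - A b * l a = k * A c := fun a b c h => by
    have : l a * A b - A b * l a
        = -((l c * l a - l a * l c) * φ a - φ a * (l c * l a - l a * l c))
          + (l c * (l a * φ a - φ a * l a) - (l a * φ a - φ a * l a) * l c) := by
      rw [← hA c a b h.rotate.rotate]
      noncomm_ring
    rw [this, hl c a b h.rotate.rotate, hc, sub_self, ← neg_neg (A c), ← hA' a b c h, mul_neg,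
      mul_sub, ← mul_assoc, ← mul_assoc, ← mul_assoc, hk]
    simp
  have d3 : ∀ a, l a * A a = A a * l a := hall _ fun a b c h => by
    rw [← sub_eq_zero]
    apply h2
    nth_rw 1 [d1 a b c h, d1 b c a h.rotate, d1 c a b h.rotate.rotate]
    simp
  refine ⟨B, fun a b c h => by rw [hA b c a h.rotate, hB a], hBφ,
    fun a b c h => by rw [hA a b c h, hAB], ?_⟩
  have f1 : k * A 2 * φ 1 + A 1 * A 2 = 0 := by
    nth_rw 2 [← hA 0 1 2 c012]
    rw [← d2 0 1 2 c012]
    have : (l 0 * A 1 - A 1 * l 0) * φ 1 + A 1 * (l 0 * φ 1 - φ 1 * l 0)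
        = l 0 * (A 1 * φ 1) - (A 1 * φ 1) * l 0 := by noncomm_ring
    rw [this, ← hB 1, hB 0, ← mul_assoc, d3, mul_assoc, hc, mul_assoc, sub_self]
  have f2 : B * (B + k) * φ 0 = k * A 2 * φ 1 + A 1 * A 2 := by
    have hkB : k * B = B * k := by
      have hkc : Commute k (A 0) := by
        rw [← hA 1 2 0 c012.rotate]
        exact ((show Commute k (l 1) from hkl 1).mul_right (hk 2)).sub_right
          ((show Commute k (φ 2) from hk 2).mul_right (hkl 1))
      rw [hB 0]
      exact (hkc.mul_right (hk 0)).eq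
    have h1 : k * A 2 * φ 1 = B * k * φ 0 := by
      rw [hAB 2, ← hBφ, mul_neg, neg_mul, ← mul_assoc, hkB, mul_assoc _ (φ 2),
        hφ' 1 2 0 c012.rotate]
      simp
    have h3 : A 1 * A 2 = B * B * φ 0 := by
      rw [hAB 1, hAB 2, neg_mul_neg, mul_assoc, ← mul_assoc B, hBφ, ← mul_assoc, ← mul_assoc,
        hφ 1 2 0 c012.rotate, mul_assoc, mul_assoc, hBφ, ← mul_assoc B, hBφ, mul_assoc]
    rw [h1, h3, mul_add, add_mul, add_comm]
  rw [f1] at f2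
  have h3 := congrArg (· * φ 0) f2
  simp only [zero_mul, mul_assoc _ (φ 0), hsq, mul_neg, mul_one, neg_eq_zero] at h3
  exact h3

section quaternionic

variable {F V : Type} [CommRing F] [Algebra ℝ F] [AddCommGroup V] [Module F V]
  [SmoothSetting F V] [ACM3 F V]

lemma et_eq (α : Fin 3) (X : V) : et F V α X = gm F V X (rxi F V α) := ACM3.eta_eq α X

lemma et_add (α : Fin 3) (X Y : V) : et F V α (X + Y) = et F V α X + et F V α Y := by
  simp only [et_eq, gm_add_left]

lemma et_neg (α : Fin 3) (X : V) : et F V α (-X) = -et F V α X := by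
  simp only [et_eq, gm_neg_left]

lemma et_sub (α : Fin 3) (X Y : V) : et F V α (X - Y) = et F V α X - et F V α Y := by
  simp only [et_eq, gm_sub_left]

lemma et_smul (α : Fin 3) (f : F) (X : V) : et F V α (f • X) = f * et F V α X := by
  simp only [et_eq, gm_smul_left]

lemma et_zero (α : Fin 3) : et F V α (0 : V) = 0 := by
  simp only [et_eq, gm_zero_left]

lemma ph_add (α : Fin 3) (X Y : V) : ph F V α (X + Y) = ph F V α X + ph F V α Y :=
  ACM3.phi_add α X Y

lemma ph_smul (α : Fin 3) (f : F) (X : V) : ph F V α (f • X) = f • ph F V α X :=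
  ACM3.phi_smul α f X

lemma ph_zero (α : Fin 3) : ph F V α (0 : V) = 0 := by
  simpa using ph_smul (F := F) α 0 (0 : V)

lemma ph_neg (α : Fin 3) (X : V) : ph F V α (-X) = -ph F V α X := by
  simpa using ph_smul (F := F) α (-1) X

lemma ph_sq (α : Fin 3) (X : V) : ph F V α (ph F V α X) = -X + et F V α X • rxi F V α :=
  ACM3.acm_sq α X

lemma et_rxi (α : Fin 3) : et F V α (rxi F V α) = 1 := ACM3.eta_xi α

lemma et_rxi_comm (α β : Fin 3) : et F V α (rxi F V β) = et F V β (rxi F V α) := by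
  rw [et_eq, et_eq, gm_comm]

lemma gm_ph_ph (α : Fin 3) (X Y : V) :
    gm F V (ph F V α X) (ph F V α Y) = gm F V X Y - et F V α X * et F V α Y :=
  ACM3.compat α X Y

section cyclic

variable {a b c : Fin 3} (h : Cyclic a b c)
include h

lemma ph_ph (X : V) : ph F V a (ph F V b X) = ph F V c X + et F V b X • rxi F V a := by
  have := ACM3.quat_phi (F := F) a b c h X
  exact (sub_eq_iff_eq_add.mp this.symm)

lemma ph_ph_swap (X : V) : ph F V b (ph F V a X) = -ph F V c X + et F V a X • rxi F V b := by
  have h1 : ph F V c X = -(ph F V b (ph F V a X)) + et F V a X • rxi F V b :=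
    ACM3.quat_phi' (F := F) a b c h X
  rw [h1]
  abel

lemma ph_rxi : ph F V a (rxi F V b) = rxi F V c := (ACM3.quat_xi (F := F) a b c h).symm

lemma ph_rxi_swap : ph F V b (rxi F V a) = -rxi F V c := by
  have h1 : rxi F V c = -(ph F V b (rxi F V a)) := ACM3.quat_xi' (F := F) a b c h
  rw [h1, neg_neg]

lemma et_ph (X : V) : et F V a (ph F V b X) = et F V c X :=
  (ACM3.quat_eta (F := F) a b c h X).symm

lemma et_ph_swap (X : V) : et F V b (ph F V a X) = -et F V c X := by
  have h1 : et F V c X = -(et F V b (ph F V a X)) := ACM3.quat_eta' (F := F) a b c h X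
  rw [h1, neg_neg]

lemma et_rxi_cyclic : et F V a (rxi F V b) = 0 := by
  apply eq_zero_of_add_self
  have h1 := et_ph (F := F) h.rotate (rxi F V b)
  rw [ph_rxi_swap h.rotate, et_neg, et_rxi_comm] at h1
  linear_combination -h1

lemma ph_rxi_self_eq : ph F V b (rxi F V b) = ph F V a (rxi F V a) := by
  have h1 := ph_ph (F := F) h.rotate (rxi F V a)
  rwa [ph_rxi h.rotate.rotate, et_rxi_cyclic h.rotate.rotate, zero_smul, add_zero] at h1

end cyclic

lemma exists_cyclic (a : Fin 3) : ∃ b c, Cyclic a b c := by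
  revert a
  unfold Cyclic
  decide

lemma eq_or_cyclic (a b : Fin 3) : a = b ∨ ∃ c, Cyclic a b c ∨ Cyclic b a c := by
  revert a b
  unfold Cyclic
  decide

lemma ph_rxi_self (α : Fin 3) : ph F V α (rxi F V α) = 0 := by
  obtain ⟨b, c, h⟩ := exists_cyclic α
  have h1 : ph F V α (ph F V α (rxi F V α)) = 0 := by
    rw [ph_sq, et_rxi, one_smul, neg_add_cancel]
  have h2 : et F V α (ph F V α (rxi F V α)) = 0 := by
    rw [← ph_rxi_self_eq h, et_ph h, et_rxi_comm, et_rxi_cyclic h.rotate]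
  have h3 := ph_sq (F := F) α (ph F V α (rxi F V α))
  rw [h1, ph_zero, h2, zero_smul, add_zero] at h3
  exact neg_eq_zero.mp h3.symm

lemma et_ph_self (α : Fin 3) (X : V) : et F V α (ph F V α X) = 0 := by
  have h1 : ph F V α (ph F V α (ph F V α X)) = -ph F V α X := by
    rw [ph_sq α X, ph_add, ph_neg, ph_smul, ph_rxi_self, smul_zero, add_zero]
  rw [ph_sq, add_eq_left] at h1
  have h2 := congrArg (et F V α) h1
  rwa [et_smul, et_rxi, mul_one, et_zero] at h2

lemma gm_ph_left (α : Fin 3) (X Y : V) :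
    gm F V (ph F V α X) Y = -gm F V X (ph F V α Y) := by
  have h := gm_ph_ph (F := F) α X (ph F V α Y)
  rw [ph_sq, et_ph_self, gm_add_right, gm_neg_right, gm_smul_right, ← et_eq, et_ph_self] at h
  linear_combination -h

lemma horiz_ph {X : V} (α : Fin 3) (hX : Horiz F V X) : Horiz F V (ph F V α X) := by
  intro β
  obtain rfl | ⟨c, h | h⟩ := eq_or_cyclic α β
  · exact et_ph_self _ _
  · rw [et_ph_swap h, hX, neg_zero]
  · rw [et_ph h, hX]

/-- `2 dη_α(X, Y) = X η_α(Y) - Y η_α(X) - η_α([X, Y])`. -/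
def etaCurl (F : Type) {V : Type} [CommRing F] [Algebra ℝ F] [AddCommGroup V] [Module F V]
    [SmoothSetting F V] [ACM3 F V] (α : Fin 3) (X Y : V) : F :=
  der F V X (et F V α Y) - der F V Y (et F V α X) - et F V α (lie F V X Y)

lemma dOne_et (α : Fin 3) (X Y : V) :
    dOne F V (et F V α) X Y = (2 : ℝ)⁻¹ • etaCurl F α X Y := rfl

lemma two_smul_dOne_et (α : Fin 3) (X Y : V) :
    (2 : ℝ) • dOne F V (et F V α) X Y = etaCurl F α X Y := by
  rw [dOne_et, smul_inv_smul₀ two_ne_zero]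

lemma etaCurl_skew (α : Fin 3) (X Y : V) : etaCurl F α X Y = -etaCurl F α Y X := by
  rw [etaCurl, etaCurl, lie_skew X Y, et_neg]
  ring

lemma etaCurl_add_left (α : Fin 3) (X Y Z : V) :
    etaCurl F α (X + Y) Z = etaCurl F α X Z + etaCurl F α Y Z := by
  simp only [etaCurl, et_add, der_add, der_add_left, lie_add_left]
  ring

lemma etaCurl_smul_left (α : Fin 3) (f : F) (X Y : V) :
    etaCurl F α (f • X) Y = f * etaCurl F α X Y := by
  simp only [etaCurl, et_smul, der_mul, der_smul_left, lie_smul_left, et_sub]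
  ring

lemma Phi_skew (α : Fin 3) (X Y : V) : Phi F V α X Y = -Phi F V α Y X := by
  rw [Phi, Phi, gm_comm Y, gm_ph_left, neg_neg]

lemma Horiz.smul {X : V} (hX : Horiz F V X) (f : F) : Horiz F V (f • X) := fun α => by
  rw [et_smul, hX, mul_zero]

/-- The horizontal vector fields. -/
def horizontal (F V : Type) [CommRing F] [Algebra ℝ F] [AddCommGroup V] [Module F V]
    [SmoothSetting F V] [ACM3 F V] : AddSubgroup V where
  carrier := {X | Horiz F V X}
  add_mem' hX hY α := by rw [et_add, hX, hY, add_zero]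
  zero_mem' α := et_zero α
  neg_mem' hX α := by rw [et_neg, hX, neg_zero]

lemma et_rxi_eq (α β : Fin 3) : et F V α (rxi F V β) = if α = β then 1 else 0 := by
  obtain rfl | ⟨c, h | h⟩ := eq_or_cyclic α β
  · rw [et_rxi, if_pos rfl]
  · rw [et_rxi_cyclic h, if_neg]
    rintro rfl
    simp [Cyclic] at h
    omega
  · rw [et_rxi_comm, et_rxi_cyclic h, if_neg]
    rintro rfl
    simp [Cyclic] at h
    omega

lemma et_sum_smul_rxi (f : Fin 3 → F) (α : Fin 3) :
    et F V α (∑ β, f β • rxi F V β) = f α := by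
  simp only [Fin.sum_univ_three, et_add, et_smul, et_rxi_eq]
  fin_cases α <;> simp

lemma gm_sum_smul_rxi (f : Fin 3 → F) (X : V) :
    gm F V (∑ β, f β • rxi F V β) X = ∑ β, f β * et F V β X := by
  simp only [Fin.sum_univ_three, gm_add_left, gm_smul_left, et_eq, gm_comm X]

lemma horiz_horComp (X : V) : Horiz F V (horComp F V X) := fun α => by
  rw [horComp, et_sub, et_sum_smul_rxi, sub_self]

lemma gm_horComp {X : V} (hX : Horiz F V X) (Y : V) :
    gm F V X (horComp F V Y) = gm F V X Y := by
  rw [horComp, gm_sub_right, gm_comm X (∑ β, _), gm_sum_smul_rxi]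
  simp [hX _]

/-- The tensor `L_{ξ_α} φ_β`. -/
def liePh (F : Type) {V : Type} [CommRing F] [Algebra ℝ F] [AddCommGroup V] [Module F V]
    [SmoothSetting F V] [ACM3 F V] (α β : Fin 3) (X : V) : V :=
  lie F V (rxi F V α) (ph F V β X) - ph F V β (lie F V (rxi F V α) X)

section normal

variable {α : Fin 3}

lemma der_et_of_isNormal (h : IsNormal F V α) (X : V) :
    der F V (rxi F V α) (et F V α X) = et F V α (lie F V (rxi F V α) X) := by
  have h1 : NOne F V α (rxi F V α) X = 0 := h _ _
  have h2 := congrArg (et F V α) h1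
  simp only [NOne, Nij, two_smul_dOne_et, ph_rxi_self, et_add, et_sub, et_ph_self, et_smul,
    et_rxi, et_zero, etaCurl, der_one] at h2
  have h3 : lie F V 0 (ph F V α X) = 0 := by
    simpa using lie_smul_left (F := F) 0 0 (ph F V α X)
  rw [h3, et_zero] at h2
  linear_combination h2

lemma lie_ph_of_isNormal (h : IsNormal F V α) (X : V) :
    lie F V (rxi F V α) (ph F V α X) = ph F V α (lie F V (rxi F V α) X) := by
  have h1 : NOne F V α (rxi F V α) X = 0 := h _ _
  have h0 : ∀ Y, lie F V 0 Y = 0 := fun Y => by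
    simpa using lie_smul_left (F := F) 0 0 Y
  have h3 : etaCurl F α (rxi F V α) X = 0 := by
    rw [etaCurl, der_et_of_isNormal h, et_rxi, der_one]
    ring
  rw [NOne, Nij, two_smul_dOne_et, h3, ph_rxi_self, h0, h0, ph_zero, zero_smul, add_zero,
    add_zero, sub_zero, sub_eq_zero] at h1
  have h4 := congrArg (ph F V α) h1
  rw [ph_sq α (ph F V α _), et_ph_self, zero_smul, add_zero, ph_sq α (lie F V _ _),
    ← der_et_of_isNormal h, et_ph_self, der_zero, zero_smul, add_zero, neg_inj] at h4
  exact h4.symm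

lemma killing_of_isQuasiSasakian (h : IsQuasiSasakian F V α) (X Y : V) :
    der F V (rxi F V α) (gm F V X Y)
      = gm F V (lie F V (rxi F V α) X) Y + gm F V X (lie F V (rxi F V α) Y) := by
  have hx := der_et_of_isNormal h.1
  have h1 := h.2 (rxi F V α) X (ph F V α Y)
  replace h1 := (smul_eq_zero.mp h1).resolve_left (by norm_num)
  have h2 : ∀ Z, Phi F V α (rxi F V α) Z = 0 := fun Z => by
    rw [Phi, gm_comm, ← et_eq, et_ph_self]
  have h3 : ∀ Z, Phi F V α Z (rxi F V α) = 0 := fun Z => by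
    rw [Phi, ph_rxi_self, gm_zero_right]
  rw [h2, h3, h3, lie_skew (ph F V α Y), lie_ph_of_isNormal h.1, der_zero, der_zero] at h1
  simp only [Phi, ph_sq, gm_neg_left, gm_add_right, gm_neg_right, gm_smul_right, ← et_eq,
    gm_ph_ph, der_add, der_neg, der_mul, hx] at h1
  rw [gm_comm (lie F V (rxi F V α) Y) X] at h1
  linear_combination -h1

end normal

end quaternionic

section threeQS

variable {F V : Type} [CommRing F] [Algebra ℝ F] [AddCommGroup V] [Module F V]
  [SmoothSetting F V] [ACM3 F V] [ThreeQS F V]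

lemma killing (α : Fin 3) (X Y : V) :
    der F V (rxi F V α) (gm F V X Y)
      = gm F V (lie F V (rxi F V α) X) Y + gm F V X (lie F V (rxi F V α) Y) :=
  killing_of_isQuasiSasakian (ThreeQS.qs α) X Y

lemma lie_rxi_ph (α : Fin 3) (X : V) :
    lie F V (rxi F V α) (ph F V α X) = ph F V α (lie F V (rxi F V α) X) :=
  lie_ph_of_isNormal (ThreeQS.qs α).1 X

lemma lie_rxi {a b c : Fin 3} (h : Cyclic a b c) :
    lie F V (rxi F V a) (rxi F V b) = algebraMap ℝ F (cc F V) • rxi F V c :=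
  ThreeQS.reeb_bracket a b c h

lemma gm_lie_rxi {X : V} (hX : Horiz F V X) (α β : Fin 3) :
    gm F V X (lie F V (rxi F V α) (rxi F V β)) = 0 := by
  obtain rfl | ⟨c, h | h⟩ := eq_or_cyclic α β
  · rw [lie_self, gm_zero_right]
  · rw [lie_rxi h, gm_smul_right, ← et_eq, hX, mul_zero]
  · rw [lie_skew, lie_rxi h, gm_neg_right, gm_smul_right, ← et_eq, hX, mul_zero, neg_zero]

lemma horiz_lie_rxi {X : V} (hX : Horiz F V X) (α : Fin 3) :
    Horiz F V (lie F V (rxi F V α) X) := by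
  intro β
  have h := killing (F := F) α X (rxi F V β)
  rw [← et_eq, hX, der_zero, gm_lie_rxi hX, add_zero, ← et_eq] at h
  exact h.symm

lemma gm_liePh (α β : Fin 3) (X Y : V) :
    gm F V X (liePh F α β Y)
      = der F V X (et F V α (ph F V β Y)) - der F V Y (et F V α (ph F V β X))
        - et F V α (ph F V β (lie F V X Y)) := by
  have h1 := (ThreeQS.qs (F := F) (V := V) β).2 (rxi F V α) X Y
  replace h1 := (smul_eq_zero.mp h1).resolve_left (by norm_num)
  have h2 : ∀ Z, Phi F V β (rxi F V α) Z = et F V α (ph F V β Z) := fun Z => by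
    rw [Phi, gm_comm, ← et_eq]
  rw [Phi_skew β Y (rxi F V α), Phi_skew β (lie F V X Y), Phi_skew β (lie F V Y _), h2, h2, h2,
    lie_skew Y, Phi, Phi, Phi, ph_neg, gm_neg_right, der_neg, killing] at h1
  rw [liePh, gm_sub_right]
  linear_combination h1

lemma gm_liePh_cyclic {a b c : Fin 3} (h : Cyclic a b c) (X Y : V) :
    gm F V X (liePh F a b Y) = etaCurl F c X Y := by
  rw [gm_liePh, et_ph h, et_ph h, et_ph h, etaCurl]

lemma liePh_swap {a b c : Fin 3} (h : Cyclic a b c) (Y : V) :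
    liePh F b a Y = -liePh F a b Y := by
  refine gm_ext F fun X => ?_
  rw [gm_comm, gm_comm _ X, gm_neg_right, gm_liePh_cyclic h, gm_liePh, et_ph_swap h,
    et_ph_swap h, et_ph_swap h, etaCurl, der_neg, der_neg]
  ring

lemma exists_horizontal_endomorphism :
    ∃ B : horizontal F V → horizontal F V,
      (∀ a b c, Cyclic a b c → ∀ X : horizontal F V, ∀ Y : V,
        gm F V (B X) Y = etaCurl F a Y (ph F V a X)) ∧
      (∀ a b c, Cyclic a b c → ∀ X : horizontal F V,
        liePh F a b (X : V) = -ph F V c (B X)) ∧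
      (∀ X Y : horizontal F V,
        (Y : V) = (B X : V) + algebraMap ℝ F (cc F V) • (X : V) → B Y = 0) := by
  let φ : Fin 3 → AddMonoid.End (horizontal F V) := fun α =>
    AddMonoidHom.mk' (fun X => ⟨ph F V α X, horiz_ph α X.2⟩) fun X Y =>
      Subtype.ext (ph_add _ _ _)
  let l : Fin 3 → AddMonoid.End (horizontal F V) := fun α =>
    AddMonoidHom.mk' (fun X => ⟨lie F V (rxi F V α) X, horiz_lie_rxi X.2 α⟩) fun X Y =>
      Subtype.ext (lie_add_right _ _ _)
  let k : AddMonoid.End (horizontal F V) :=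
    AddMonoidHom.mk' (fun X => ⟨algebraMap ℝ F (cc F V) • (X : V), Horiz.smul X.2 _⟩)
      fun X Y => Subtype.ext (smul_add _ _ _)
  have hφv : ∀ α X, ((φ α X : horizontal F V) : V) = ph F V α X := fun _ _ => rfl
  have hlv : ∀ α X, ((l α X : horizontal F V) : V) = lie F V (rxi F V α) X := fun _ _ => rfl
  have hkv : ∀ X, ((k X : horizontal F V) : V) = algebraMap ℝ F (cc F V) • (X : V) :=
    fun _ => rfl
  have hsq : ∀ a, φ a * φ a = -1 := fun a => AddMonoidHom.ext fun X => Subtype.ext <| by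
    change ph F V a (ph F V a X) = -(X : V)
    rw [ph_sq, X.2 a, zero_smul, add_zero]
  have hφ : ∀ a b c, Cyclic a b c → φ a * φ b = φ c := fun a b c h =>
    AddMonoidHom.ext fun X => Subtype.ext <| by
      change ph F V a (ph F V b X) = ph F V c X
      rw [ph_ph h, X.2 b, zero_smul, add_zero]
  have hφ' : ∀ a b c, Cyclic a b c → φ b * φ a = -φ c := fun a b c h =>
    AddMonoidHom.ext fun X => Subtype.ext <| by
      change ph F V b (ph F V a X) = -ph F V c X
      rw [ph_ph_swap h, X.2 a, zero_smul, add_zero]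
  have hl : ∀ a b c, Cyclic a b c → l a * l b - l b * l a = k * l c := fun a b c h =>
    AddMonoidHom.ext fun X => Subtype.ext <| by
      change lie F V (rxi F V a) (lie F V (rxi F V b) X)
        - lie F V (rxi F V b) (lie F V (rxi F V a) X)
          = algebraMap ℝ F (cc F V) • lie F V (rxi F V c) X
      rw [lie_jacobi, add_sub_cancel_right, lie_rxi h, lie_smul_left, der_const, zero_smul,
        sub_zero]
  have hc : ∀ a, l a * φ a = φ a * l a := fun a =>
    AddMonoidHom.ext fun X => Subtype.ext <| lie_rxi_ph a (X : V)
  have hk : ∀ a, k * φ a = φ a * k := fun a =>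
    AddMonoidHom.ext fun X => Subtype.ext (ph_smul a _ (X : V)).symm
  have hkl : ∀ a, k * l a = l a * k := fun a =>
    AddMonoidHom.ext fun X => Subtype.ext (lie_algebraMap_smul (rxi F V a) _ (X : V)).symm
  have ha : ∀ a b c, Cyclic a b c → l b * φ a - φ a * l b = -(l a * φ b - φ b * l a) :=
    fun a b c h => AddMonoidHom.ext fun X => Subtype.ext <| liePh_swap h (X : V)
  have h2 : ∀ x : AddMonoid.End (horizontal F V), x + x = 0 → x = 0 := fun x hx =>
    AddMonoidHom.ext fun X => Subtype.ext <| gm_ext F fun Z => by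
      have h1 := congrArg (fun y : AddMonoid.End (horizontal F V) => gm F V (y X) Z) hx
      change gm F V ((x X : V) + x X) Z = gm F V 0 Z at h1
      change gm F V (x X) Z = gm F V 0 Z
      rw [gm_add_left, gm_zero_left] at h1
      rw [gm_zero_left]
      exact eq_zero_of_add_self h1
  obtain ⟨B, hB1, -, hB2, hB3⟩ := exists_commutator_eq h2 hsq hφ hφ' hl hc hk hkl ha
  refine ⟨B, fun a b c h X Y => ?_, fun a b c h X => ?_, fun X Y hY => ?_⟩
  · rw [gm_comm, ← gm_liePh_cyclic h.rotate, hB1 a b c h]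
    rfl
  · exact congrArg Subtype.val (DFunLike.congr_fun (hB2 a b c h) X)
  · rw [show Y = (B + k) X from Subtype.ext hY]
    exact DFunLike.congr_fun hB3 X

lemma liePh_eq_smul_psiT {a b c : Fin 3} (h : Cyclic a b c) {Y : V} (hY : Horiz F V Y) :
    liePh F a b Y = algebraMap ℝ F (cc F V) • psiT F V c Y := by
  obtain ⟨B, hB1, hB2, hB3⟩ := exists_horizontal_endomorphism (F := F) (V := V)
  have hm : ∀ X : horizontal F V, InE4m F V X ↔ B X = 0 := by
    intro X
    constructor
    · intro hX
      have h1 : ph F V c (B X) = 0 := by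
        rw [← neg_eq_zero, ← hB2 a b c h]
        refine gm_ext F fun Z => ?_
        rw [gm_zero_left, gm_comm, gm_liePh_cyclic h, etaCurl_skew, ← two_smul_dOne_et,
          hX.2, smul_zero, neg_zero]
      have h2 := ph_sq (F := F) c (B X : V)
      rw [h1, ph_zero, (B X).2 c, zero_smul, add_zero, eq_comm, neg_eq_zero] at h2
      exact Subtype.ext h2
    · intro hX
      refine ⟨X.2, fun α Z => ?_⟩
      obtain ⟨β, γ, hc⟩ := exists_cyclic α
      rw [dOne_et, etaCurl_skew, ← gm_liePh_cyclic hc.rotate, hB2 β γ α hc.rotate, hX]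
      simp [ph_zero, gm_zero_right]
  have hsymm : ∀ X Y : horizontal F V, gm F V (B X) Y = gm F V X (B Y) := fun X Y => by
    rw [hB1 a b c h, etaCurl_skew, ← gm_liePh_cyclic h.rotate, hB2 b c a h.rotate,
      gm_neg_right, neg_neg, gm_ph_ph, X.2 a, zero_mul, sub_zero]
  obtain ⟨P, Q, hP, hQ, rfl⟩ := ThreeQS.horiz_split Y hY
  have hQ' : liePh F a b Q = 0 := by
    have h1 := hB2 a b c h ⟨Q, hQ.1⟩
    rwa [(hm ⟨Q, hQ.1⟩).mp hQ, ZeroMemClass.coe_zero, ph_zero, neg_zero] at h1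
  have hadd : liePh F a b (P + Q) = liePh F a b P + liePh F a b Q := by
    simp only [liePh, lie_add_right, ph_add]
    abel
  have hψ : psiT F V c (P + Q) = ph F V c P := by
    rw [psiT, ThreeQS.psi_add, ThreeQS.psi_E4l c P hP, ThreeQS.psi_E4m c Q hQ, add_zero]
  let P' : horizontal F V := ⟨P, hP.1⟩
  let W : horizontal F V := B P' + ⟨algebraMap ℝ F (cc F V) • P, hP.1.smul _⟩
  have hWm : InE4m F V W := (hm W).mpr (hB3 P' W rfl)
  have hWl : ∀ Z, InE4m F V Z → gm F V W Z = 0 := fun Z hZ => by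
    change gm F V ((B P' : V) + algebraMap ℝ F (cc F V) • P) Z = 0
    rw [gm_add_left, gm_smul_left, hP.2 Z hZ, hsymm P' ⟨Z, hZ.1⟩, (hm ⟨Z, hZ.1⟩).mp hZ,
      ZeroMemClass.coe_zero, gm_zero_right, mul_zero, add_zero]
  have hW : (W : V) = 0 := by
    refine gm_ext F fun Z => ?_
    have hZ : Horiz F V (horComp F V Z) := horiz_horComp Z
    obtain ⟨Z₁, Z₂, hZ₁, hZ₂, hZe⟩ := ThreeQS.horiz_split _ hZ
    rw [gm_zero_left, ← gm_horComp W.2, hZe, gm_add_right, hWl Z₂ hZ₂, gm_comm, hZ₁.2 _ hWm,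
      add_zero]
  have hBP : (B P' : V) = -(algebraMap ℝ F (cc F V) • P) := eq_neg_of_add_eq_zero_left hW
  rw [hadd, hQ', add_zero, hψ, hB2 a b c h P', hBP, ph_neg, ph_smul, neg_neg]

/-- The torsion `2 ∑_α dη_α ⊗ ξ_α` of the canonical connection. -/
def canonicalTorsion (F : Type) {V : Type} [CommRing F] [Algebra ℝ F] [AddCommGroup V]
    [Module F V] [SmoothSetting F V] [ACM3 F V] (X Y : V) : V :=
  ∑ α, etaCurl F α X Y • rxi F V α

omit [ThreeQS F V] in
lemma canonicalTorsion_skew (X Y : V) :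
    canonicalTorsion F X Y = -canonicalTorsion F Y X := by
  rw [canonicalTorsion, canonicalTorsion, ← Finset.sum_neg_distrib]
  exact Finset.sum_congr rfl fun α _ => by rw [etaCurl_skew, neg_smul]

omit [ThreeQS F V] in
lemma canonicalTorsion_add_left (X Y Z : V) :
    canonicalTorsion F (X + Y) Z = canonicalTorsion F X Z + canonicalTorsion F Y Z := by
  simp only [canonicalTorsion, etaCurl_add_left, add_smul, Finset.sum_add_distrib]

omit [ThreeQS F V] in
lemma canonicalTorsion_smul_left (f : F) (X Y : V) :
    canonicalTorsion F (f • X) Y = f • canonicalTorsion F X Y := by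
  simp only [canonicalTorsion, etaCurl_smul_left, mul_smul, Finset.smul_sum]

omit [ThreeQS F V] in
lemma der_et_rxi (X : V) (α β : Fin 3) : der F V X (et F V α (rxi F V β)) = 0 := by
  rw [et_rxi_eq]
  split_ifs
  exacts [der_one X, der_zero X]

lemma etaCurl_rxi (α β : Fin 3) (X : V) :
    etaCurl F β X (rxi F V α) = -gm F V X (lie F V (rxi F V α) (rxi F V β)) := by
  rw [etaCurl, der_et_rxi, et_eq, et_eq, killing, lie_skew X, gm_neg_left]
  ring

lemma Cyclic.sum_eq {M : Type*} [AddCommMonoid M] {a b c : Fin 3} (h : Cyclic a b c)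
    (f : Fin 3 → M) : ∑ α, f α = f a + f b + f c := by
  rw [Fin.sum_univ_three]
  simp only [Cyclic, Prod.mk.injEq] at h
  obtain ⟨rfl, rfl, rfl⟩ | ⟨rfl, rfl, rfl⟩ | ⟨rfl, rfl, rfl⟩ := h
  · rfl
  · abel
  · abel

lemma canonicalTorsion_rxi_skew (α : Fin 3) (X Z : V) :
    gm F V (canonicalTorsion F X (rxi F V α)) Z
      + gm F V (canonicalTorsion F Z (rxi F V α)) X = 0 := by
  obtain ⟨b, c, h⟩ := exists_cyclic α
  rw [canonicalTorsion, canonicalTorsion, gm_sum_smul_rxi, gm_sum_smul_rxi, h.sum_eq, h.sum_eq]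
  simp only [etaCurl_rxi, lie_self, lie_rxi h, lie_skew (rxi F V α) (rxi F V c),
    lie_rxi h.rotate.rotate, gm_neg_right, gm_smul_right, gm_zero_right, ← et_eq]
  ring

/-- The defining properties of the canonical connection. -/
structure IsCanonical (F : Type) {V : Type} [CommRing F] [Algebra ℝ F] [AddCommGroup V]
    [Module F V] [SmoothSetting F V] [ACM3 F V] (D : V → V → V) : Prop where
  conn : IsConnection F V D
  et_parallel : ∀ (α : Fin 3) (X Y : V), der F V X (et F V α Y) = et F V α (D X Y)
  rxi_parallel : ∀ (α : Fin 3) (X : V), D X (rxi F V α) = 0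
  metric : ∀ X Y Z : V,
    der F V X (gm F V Y Z) = gm F V (D X Y) Z + gm F V Y (D X Z)
  torsion : ∀ X Y : V, D X Y - D Y X - lie F V X Y = canonicalTorsion F X Y

variable (F V) in
lemma metricConn_isCanonical : IsCanonical F (metricConn F (canonicalTorsion F (V := V))) := by
  have hs := canonicalTorsion_skew (F := F) (V := V)
  have ha := canonicalTorsion_add_left (F := F) (V := V)
  have hm := canonicalTorsion_smul_left (F := F) (V := V)
  have hξ : ∀ (α : Fin 3) (X : V),
      metricConn F (canonicalTorsion F) X (rxi F V α) = 0 := by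
    intro α X
    refine gm_ext F fun Z => ?_
    have h1 := canonicalTorsion_rxi_skew (F := F) α X Z
    have h2 := killing (F := F) α Z X
    have h3 : gm F V (canonicalTorsion F Z X) (rxi F V α) = etaCurl F α Z X := by
      rw [← et_eq, canonicalTorsion, et_sum_smul_rxi]
    rw [gm_metricConn hs ha hm, gm_zero_left, koszul, h3, hs (rxi F V α) Z, lie_skew X,
      lie_skew Z X, gm_comm (rxi F V α) Z, ← et_eq, ← et_eq, gm_neg_left, gm_neg_left,
      gm_neg_left, ← et_eq, etaCurl, lie_skew Z X, et_neg]
    rw [gm_comm Z (lie F V _ X)] at h2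
    linear_combination algebraMap ℝ F 2⁻¹ * (h1 + h2)
  refine ⟨metricConn_isConnection hs ha hm, fun α X Y => ?_, hξ, metricConn_metric hs ha hm,
    metricConn_torsion hs ha hm⟩
  rw [et_eq, metricConn_metric hs ha hm, hξ, gm_zero_right, add_zero, et_eq]

/-- The covariant derivative `(D_X φ_α) Y`. -/
def covPh (F : Type) {V : Type} [CommRing F] [Algebra ℝ F] [AddCommGroup V] [Module F V]
    [SmoothSetting F V] [ACM3 F V] (D : V → V → V) (α : Fin 3) (X Y : V) : V :=
  D X (ph F V α Y) - ph F V α (D X Y)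

namespace IsCanonical

variable {D : V → V → V} (hD : IsCanonical F D)
include hD

omit [ThreeQS F V] in
lemma horiz (X : V) {Y : V} (hY : Horiz F V Y) : Horiz F V (D X Y) := fun α => by
  rw [← hD.et_parallel, hY, der_zero]

omit [ThreeQS F V] in
lemma gm_lie (X Y : V) {Z : V} (hZ : Horiz F V Z) :
    gm F V (lie F V X Y) Z = gm F V (D X Y) Z - gm F V (D Y X) Z := by
  have h := congrArg (gm F V · Z) (hD.torsion X Y)
  simp only [gm_sub_left, canonicalTorsion, gm_sum_smul_rxi, hZ _, mul_zero,
    Finset.sum_const_zero] at h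
  linear_combination -h

omit [ThreeQS F V] hD in
lemma gm_covPh (α : Fin 3) (X Y Z : V) : gm F V (covPh F D α X Y) Z
    = gm F V (D X (ph F V α Y)) Z + gm F V (D X Y) (ph F V α Z) := by
  rw [covPh, gm_sub_left, gm_ph_left, sub_neg_eq_add]

omit [ThreeQS F V] in
lemma gm_covPh_skew (α : Fin 3) (X Y Z : V) :
    gm F V (covPh F D α X Y) Z = -gm F V (covPh F D α X Z) Y := by
  have h1 := hD.metric X (ph F V α Y) Z
  rw [gm_ph_left, der_neg, hD.metric, gm_comm (ph F V α Y), gm_comm Y] at h1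
  rw [gm_covPh, gm_covPh]
  linear_combination -h1

omit [ThreeQS F V] in
lemma gm_covPh_ph (α : Fin 3) (X : V) {Y Z : V} (hY : Horiz F V Y) (hZ : Horiz F V Z) :
    gm F V (covPh F D α X (ph F V α Y)) Z = gm F V (covPh F D α X Y) (ph F V α Z) := by
  have hn : D X (-Y) = -D X Y := by
    simpa [der_neg, der_one] using hD.conn.2.2.2 X (-1) Y
  rw [gm_covPh, gm_covPh, ph_sq, ph_sq, hY, hZ, zero_smul, add_zero, add_zero,
    hn, gm_neg_left, gm_neg_right]
  ring

lemma gm_covPh_cyclic (α : Fin 3) {X Y Z : V} (hX : Horiz F V X) (hY : Horiz F V Y)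
    (hZ : Horiz F V Z) : gm F V (covPh F D α X Y) Z + gm F V (covPh F D α Y Z) X
      + gm F V (covPh F D α Z X) Y = 0 := by
  have h1 := (ThreeQS.qs (F := F) (V := V) α).2 X Y Z
  replace h1 := (smul_eq_zero.mp h1).resolve_left (by norm_num)
  simp only [Phi, hD.gm_lie _ _ (horiz_ph α hX), hD.gm_lie _ _ (horiz_ph α hY),
    hD.gm_lie _ _ (horiz_ph α hZ), hD.metric] at h1
  rw [hD.gm_covPh_skew α X, hD.gm_covPh_skew α Y, hD.gm_covPh_skew α Z, gm_covPh,
    gm_covPh, gm_covPh, gm_comm _ Y, gm_comm _ Z, gm_comm _ X]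
  linear_combination -h1

lemma gm_covPh_symm (α : Fin 3) {X Y Z : V} (hZ : Horiz F V Z) :
    gm F V (covPh F D α (ph F V α X) Y) Z + gm F V (covPh F D α X Y) (ph F V α Z)
      = gm F V (covPh F D α (ph F V α Y) X) Z + gm F V (covPh F D α Y X) (ph F V α Z) := by
  have h1 : NOne F V α X Y = 0 := (ThreeQS.qs (F := F) (V := V) α).1 X Y
  have h2 := congrArg (gm F V · Z) h1
  have hφZ := horiz_ph α hZ
  simp only [NOne, Nij, gm_add_left, gm_sub_left, gm_smul_left, gm_ph_left, ph_sq,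
    gm_comm (rxi F V α) Z, ← et_eq, hZ _, add_zero, gm_neg_left, mul_zero,
    gm_zero_left, hD.gm_lie _ _ hZ, hD.gm_lie _ _ hφZ] at h2
  simp only [gm_covPh, ph_sq, hZ _, zero_smul, add_zero, gm_neg_right]
  linear_combination h2

lemma gm_covPh_horiz (α : Fin 3) {X Y Z : V} (hX : Horiz F V X) (hY : Horiz F V Y)
    (hZ : Horiz F V Z) : gm F V (covPh F D α X Y) Z = 0 := by
  have hq : ∀ {X Y Z : V}, Horiz F V X → Horiz F V Y → Horiz F V Z →
      gm F V (covPh F D α (ph F V α X) Y) Z = -gm F V (covPh F D α X Y) (ph F V α Z) := by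
    intro X Y Z hX hY hZ
    rw [← add_eq_zero_iff_eq_neg]
    refine eq_zero_of_symm_of_skew (p := Horiz F V)
      (S := fun X Y Z => gm F V (covPh F D α (ph F V α X) Y) Z
        + gm F V (covPh F D α X Y) (ph F V α Z))
      (fun X Y Z _ _ hZ => hD.gm_covPh_symm α hZ) (fun X Y Z hX hY hZ => ?_) hX hY hZ
    rw [hD.gm_covPh_skew α (ph F V α X), ← hD.gm_covPh_ph α X hY hZ,
      hD.gm_covPh_skew α X (ph F V α Y)]
    ring
  have hsq : ∀ {W : V}, Horiz F V W → ph F V α (ph F V α W) = -W := fun {W} hW => by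
    rw [ph_sq, hW, zero_smul, add_zero]
  have hφ : ∀ {W : V}, Horiz F V W → Horiz F V (ph F V α W) := fun {W} hW => horiz_ph α hW
  have h1 := hD.gm_covPh_cyclic α hX hY hZ
  have h2 := hD.gm_covPh_cyclic α hX (hφ hY) (hφ hZ)
  rw [hD.gm_covPh_ph α X hY (hφ hZ), hsq hZ, hq hY (hφ hZ) hX,
    hD.gm_covPh_ph α Y hZ (hφ hX), hsq hX, hq hZ hX (hφ hY), hsq hY, gm_neg_right,
    gm_neg_right, gm_neg_right] at h2
  apply eq_zero_of_add_self
  linear_combination h1 - h2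

lemma covPh_eq_zero (α : Fin 3) {X Y : V} (hX : Horiz F V X) (hY : Horiz F V Y) :
    covPh F D α X Y = 0 := by
  have h : Horiz F V (covPh F D α X Y) :=
    (horizontal F V).sub_mem (hD.horiz X (horiz_ph α hY)) (horiz_ph α (hD.horiz X hY))
  refine gm_ext F fun Z => ?_
  rw [gm_zero_left, ← gm_horComp h, hD.gm_covPh_horiz α hX hY (horiz_horComp Z)]

lemma apply_rxi_left (α : Fin 3) {Y : V} (hY : Horiz F V Y) :
    D (rxi F V α) Y = lie F V (rxi F V α) Y := by
  have h := hD.torsion (rxi F V α) Y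
  have h0 : canonicalTorsion F (rxi F V α) Y = 0 := by
    rw [canonicalTorsion_skew, canonicalTorsion]
    simp [etaCurl_rxi, gm_lie_rxi hY]
  rwa [hD.rxi_parallel, sub_zero, h0, sub_eq_zero] at h

lemma covPh_rxi_left (α β : Fin 3) {Y : V} (hY : Horiz F V Y) :
    covPh F D α (rxi F V β) Y = liePh F β α Y := by
  rw [covPh, hD.apply_rxi_left β hY, hD.apply_rxi_left β (horiz_ph α hY), liePh]

omit [ThreeQS F V] in
lemma covPh_rxi_right (α β : Fin 3) (X : V) : covPh F D α X (rxi F V β) = 0 := by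
  have hn : ∀ Y, D X (-Y) = -D X Y := fun Y => by
    simpa [der_neg, der_one] using hD.conn.2.2.2 X (-1) Y
  have h0 : D X 0 = 0 := by simpa [der_zero] using hD.conn.2.2.2 X 0 0
  rw [covPh, hD.rxi_parallel, ph_zero, sub_zero]
  obtain rfl | ⟨c, h | h⟩ := eq_or_cyclic α β
  · rw [ph_rxi_self, h0]
  · rw [ph_rxi h, hD.rxi_parallel]
  · rw [ph_rxi_swap h, hn, hD.rxi_parallel, neg_zero]

omit [ThreeQS F V] in
lemma covPh_add_left (α : Fin 3) (X Y Z : V) :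
    covPh F D α (X + Y) Z = covPh F D α X Z + covPh F D α Y Z := by
  simp only [covPh, hD.conn.1, ph_add]
  abel

omit [ThreeQS F V] in
lemma covPh_smul_left (α : Fin 3) (f : F) (X Y : V) :
    covPh F D α (f • X) Y = f • covPh F D α X Y := by
  simp only [covPh, hD.conn.2.1, ph_smul, smul_sub]

omit [ThreeQS F V] in
lemma covPh_add_right (α : Fin 3) (X Y Z : V) :
    covPh F D α X (Y + Z) = covPh F D α X Y + covPh F D α X Z := by
  simp only [covPh, hD.conn.2.2.1, ph_add]
  abel

omit [ThreeQS F V] in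
lemma covPh_smul_right (α : Fin 3) (f : F) (X Y : V) :
    covPh F D α X (f • Y) = f • covPh F D α X Y := by
  simp only [covPh, hD.conn.2.2.2, ph_smul, ph_add, smul_sub]
  abel

omit [ThreeQS F V] in
lemma covPh_horComp (α : Fin 3) (X Y : V) :
    covPh F D α X (horComp F V Y) = covPh F D α X Y := by
  have h : Y = horComp F V Y + ∑ β, et F V β Y • rxi F V β := (sub_add_cancel _ _).symm
  conv_rhs => rw [h]
  rw [hD.covPh_add_right, Fin.sum_univ_three, hD.covPh_add_right, hD.covPh_add_right]
  simp only [hD.covPh_smul_right, hD.covPh_rxi_right, smul_zero, add_zero]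

lemma covPh_eq {a b c : Fin 3} (h : Cyclic a b c) (X Y : V) :
    covPh F D a X Y = -(algebraMap ℝ F (cc F V) •
      (et F V b X • psiT F V c (horComp F V Y) - et F V c X • psiT F V b (horComp F V Y))) := by
  have hY : Horiz F V (horComp F V Y) := horiz_horComp Y
  have hX : X = horComp F V X + ∑ β, et F V β X • rxi F V β := (sub_add_cancel _ _).symm
  have h0 : liePh F a a (horComp F V Y) = 0 := sub_eq_zero.mpr (lie_rxi_ph a _)
  rw [← hD.covPh_horComp]
  nth_rw 1 [hX]
  rw [hD.covPh_add_left, hD.covPh_eq_zero a (horiz_horComp X) hY, zero_add, h.sum_eq,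
    hD.covPh_add_left, hD.covPh_add_left, hD.covPh_smul_left, hD.covPh_smul_left,
    hD.covPh_smul_left, hD.covPh_rxi_left a a hY, hD.covPh_rxi_left a b hY,
    hD.covPh_rxi_left a c hY, h0, liePh_swap h, liePh_eq_smul_psiT h hY,
    liePh_eq_smul_psiT h.rotate.rotate hY]
  module

end IsCanonical

end threeQS


/-- On a 3-quasi-Sasakian manifold there is a unique linear
connection `∇̃` with `∇̃η_α = 0`, `∇̃ξ_α = 0`, `∇̃g = 0` and torsion
`T̃(X,Y) = 2 ∑_α dη_α(X,Y) ξ_α`; furthermore, for any cyclic permutation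
`(α,β,γ)`, `(∇̃_X φ_α)Y = -c(η_β(X) ψ_γ(Y_H) - η_γ(X) ψ_β(Y_H))`. -/
theorem canonical_connection (F V : Type) [CommRing F] [Algebra ℝ F] [AddCommGroup V] [Module F V]
    [SmoothSetting F V] [ACM3 F V] [ThreeQS F V] :
    ∃ D : V → V → V,
      (IsConnection F V D ∧
        (∀ (α : Fin 3) (X Y : V),
          der F V X (et F V α Y) - et F V α (D X Y) = 0) ∧
        (∀ (α : Fin 3) (X : V), D X (rxi F V α) = 0) ∧
        (∀ X Y Z : V,
          der F V X (gm F V Y Z) = gm F V (D X Y) Z + gm F V Y (D X Z)) ∧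
        (∀ X Y : V, D X Y - D Y X - lie F V X Y
          = ∑ α : Fin 3, ((2 : ℝ) • dOne F V (et F V α) X Y) • rxi F V α)) ∧
      (∀ a b c' : Fin 3, Cyclic a b c' → ∀ X Y : V,
        D X (ph F V a Y) - ph F V a (D X Y)
          = -(algebraMap ℝ F (cc F V) •
              (et F V b X • psiT F V c' (horComp F V Y)
                - et F V c' X • psiT F V b (horComp F V Y)))) ∧
      (∀ D' : V → V → V,
        (IsConnection F V D' ∧
        (∀ (α : Fin 3) (X Y : V),
          der F V X (et F V α Y) - et F V α (D' X Y) = 0) ∧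
        (∀ (α : Fin 3) (X : V), D' X (rxi F V α) = 0) ∧
        (∀ X Y Z : V,
          der F V X (gm F V Y Z) = gm F V (D' X Y) Z + gm F V Y (D' X Z)) ∧
        (∀ X Y : V, D' X Y - D' Y X - lie F V X Y
          = ∑ α : Fin 3, ((2 : ℝ) • dOne F V (et F V α) X Y) • rxi F V α)) → D' = D) := by
  have hT : ∀ X Y : V, ∑ α : Fin 3, ((2 : ℝ) • dOne F V (et F V α) X Y) • rxi F V α
      = canonicalTorsion F X Y := fun X Y => by
    simp only [two_smul_dOne_et, canonicalTorsion]
  have hD := metricConn_isCanonical F V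
  refine ⟨_, ⟨hD.conn, fun α X Y => sub_eq_zero.mpr (hD.et_parallel α X Y), hD.rxi_parallel,
    hD.metric, fun X Y => (hD.torsion X Y).trans (hT X Y).symm⟩,
    fun a b c' h X Y => hD.covPh_eq h X Y, ?_⟩
  rintro D' ⟨-, -, -, hm, ht⟩
  refine metric_connection_unique hD.metric hm fun X Y => ?_
  have h1 := (hD.torsion X Y).trans ((hT X Y).symm.trans (ht X Y).symm)
  exact sub_left_inj.mp h1

end QS3
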